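/- Let p = 2ℓ+1 be an odd prime and let λ be a restricted p-strict partition of n. For each i ∈ {0,1,…,ℓ}, let γ_i denote the number of nodes of λ of residue i. Then a_p(λ) ≡ γ_1 + γ_2 + ⋯ + γ_ℓ (mod 2). -/

import Mathlib

/-- The columns `1, …, m` of nonzero residue number `m - 2 ⌊m / p⌋`, less one more
if `p` does not divide `m`. -/
theorem sum_card_nonzero_residue (ℓ p : ℕ) (hℓ : 0 < ℓ) (hpl : p = 2 * ℓ + 1) (m : ℕ) :
    (∑ i ∈ Finset.Icc 1 ℓ, ((Finset.Icc 1 m).filter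
        (fun s => ℓ - ((s - 1) % p - ℓ + (ℓ - (s - 1) % p)) = i)).card)
      + 2 * (m / p) + (if p ∣ m then 0 else 1) = m := by
  induction m with
  | zero => simp
  | succ m ih =>
    have hstep : ∀ i, ((Finset.Icc 1 (m + 1)).filter
        (fun s => ℓ - ((s - 1) % p - ℓ + (ℓ - (s - 1) % p)) = i)).card =
        ((Finset.Icc 1 m).filter
        (fun s => ℓ - ((s - 1) % p - ℓ + (ℓ - (s - 1) % p)) = i)).card +
        if ℓ - (m % p - ℓ + (ℓ - m % p)) = i then 1 else 0 := by
      intro i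
      rw [← Finset.insert_Icc_right_eq_Icc_add_one (by omega), Finset.filter_insert]
      split_ifs with h₁ h₂ h₂
      · rw [Finset.card_insert_of_notMem (by simp)]
      · simp_all
      · simp_all
      · rfl
    simp only [hstep, Finset.sum_add_distrib, Finset.sum_ite_eq, Finset.mem_Icc]
    have hlt : m % p < p := Nat.mod_lt _ (by omega)
    have hdvd : p ∣ m ↔ m % p = 0 := Nat.dvd_iff_mod_eq_zero
    have hdvd' : p ∣ m + 1 ↔ m % p = p - 1 := by
      rw [Nat.dvd_iff_mod_eq_zero, Nat.add_mod, Nat.mod_eq_of_lt (show 1 < p by omega)]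
      by_cases h : m % p = p - 1
      · simp [h, Nat.sub_add_cancel (show 1 ≤ p by omega)]
      · rw [Nat.mod_eq_of_lt (by omega)]
        omega
    rw [Nat.succ_div]
    simp only [hdvd, hdvd'] at ih ⊢
    split_ifs at ih ⊢ <;> omega

/-- Let `p = 2ℓ+1` be an odd prime and `λ` a restricted `p`-strict partition
of `n` (given here as an antitone finitely-supported sequence `lam 0 ≥ lam 1 ≥ ⋯` of parts).
Writing `γ i` for the number of nodes `(r,s)` of `λ` of residue `i`, where the residue of a
node in column `s` is `ℓ − |((s−1) mod p) − ℓ|`, and `a_p(λ) ∈ {0,1}` for the parity marker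
which is `0` iff `n − h_{p'}(λ)` is even (`h_{p'}(λ)` the number of parts not divisible by
`p`), we have `a_p(λ) ≡ γ 1 + γ 2 + ⋯ + γ ℓ (mod 2)`. -/
theorem ap_parity_eq_sum_of_nonzero_residue_nodes
    (ℓ p : ℕ) (hpl : p = 2 * ℓ + 1) (hprime : p.Prime)
    (n : ℕ) (lam : ℕ → ℕ)
    (hanti : ∀ r, lam (r + 1) ≤ lam r)
    (hfin : (Function.support lam).Finite)
    (hsum : ∑ᶠ r, lam r = n)
    (hstrict : ∀ r, lam r = lam (r + 1) → 0 < lam r → p ∣ lam r)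
    (hrestricted : ∀ r, lam r - lam (r + 1) < p ∨ (lam r - lam (r + 1) = p ∧ ¬ p ∣ lam r)) :
    (if Even (n - Nat.card {r : ℕ // lam r ≠ 0 ∧ ¬ p ∣ lam r}) then 0 else 1) ≡
      (∑ i ∈ Finset.Icc 1 ℓ, ∑ᶠ r : ℕ, ((Finset.Icc 1 (lam r)).filter
        (fun s => ℓ - ((s - 1) % p - ℓ + (ℓ - (s - 1) % p)) = i)).card) [MOD 2] := by
  have hℓ : 0 < ℓ := by
    have := hprime.two_le
    omega
  have hsupp : ∀ f : ℕ → ℕ, f 0 = 0 → ∑ᶠ r, f (lam r) = ∑ r ∈ hfin.toFinset, f (lam r) := by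
    intro f hf
    refine finsum_eq_sum_of_support_subset _ fun r hr => ?_
    simp only [Set.Finite.coe_toFinset, Function.mem_support] at hr ⊢
    exact fun h => hr (by rw [h, hf])
  have hcard : Nat.card {r : ℕ // lam r ≠ 0 ∧ ¬ p ∣ lam r} =
      ∑ r ∈ hfin.toFinset, if p ∣ lam r then 0 else 1 := by
    rw [Nat.subtype_card (hfin.toFinset.filter fun r => ¬ p ∣ lam r) (by simp),
      Finset.card_filter]
    simp only [ite_not]
  have hn : n = ∑ r ∈ hfin.toFinset, lam r := by
    rw [← hsum]
    exact hsupp id rfl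
  have hγ : (∑ i ∈ Finset.Icc 1 ℓ, ∑ᶠ r : ℕ, ((Finset.Icc 1 (lam r)).filter
        (fun s => ℓ - ((s - 1) % p - ℓ + (ℓ - (s - 1) % p)) = i)).card) =
      ∑ r ∈ hfin.toFinset, ∑ i ∈ Finset.Icc 1 ℓ, ((Finset.Icc 1 (lam r)).filter
        (fun s => ℓ - ((s - 1) % p - ℓ + (ℓ - (s - 1) % p)) = i)).card := by
    rw [Finset.sum_comm]
    exact Finset.sum_congr rfl fun i _ => hsupp (fun m => ((Finset.Icc 1 m).filter
        (fun s => ℓ - ((s - 1) % p - ℓ + (ℓ - (s - 1) % p)) = i)).card) (by simp)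
  have htotal := Finset.sum_congr (rfl : hfin.toFinset = hfin.toFinset) fun r _ =>
    sum_card_nonzero_residue ℓ p hℓ hpl (lam r)
  rw [Finset.sum_add_distrib, Finset.sum_add_distrib, ← Finset.mul_sum, ← hγ, ← hcard, ← hn]
    at htotal
  rw [Nat.ModEq]
  split_ifs with h <;> rw [Nat.even_iff] at h <;> omega
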